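/- Let ≃f be the smallest congruence on modal formulas containing A ∧ B ≃f B ∧ A, A ∧ (B ∧ C) ≃f (A ∧ B) ∧ C, and (A ∧ B) ⊃ C ≃f A ⊃ (B ⊃ C). For all modal formulas F and G: F ≃f G if and only if [[F]] and [[G]] are isomorphic as L-labeled two-color DAGs. -/

import Mathlib

set_option linter.unusedVariables false

/-! ### Modal formulas -/

/-- Modal formulas: `A ::= a | A ⊃ B | A ∧ B | □A | ◇A | ◇⊥`. -/
inductive MForm : Type
  | atom : ℕ → MForm
  | imp : MForm → MForm → MForm
  | conj : MForm → MForm → MForm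
  | box : MForm → MForm
  | dia : MForm → MForm
  | diaBot : MForm
deriving DecidableEq

/-- A formula is modality-free if it contains no `□` and no `◇`. -/
def MForm.ModalityFree : MForm → Prop
  | .atom _ => True
  | .imp A B => A.ModalityFree ∧ B.ModalityFree
  | .conj A B => A.ModalityFree ∧ B.ModalityFree
  | .box _ => False
  | .dia _ => False
  | .diaBot => False

/-- A formula contains no occurrence of `◇⊥`. -/
def MForm.NoDiaBot : MForm → Prop
  | .atom _ => True
  | .imp A B => A.NoDiaBot ∧ B.NoDiaBot
  | .conj A B => A.NoDiaBot ∧ B.NoDiaBot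
  | .box A => A.NoDiaBot
  | .dia A => A.NoDiaBot
  | .diaBot => False

/-! ### Sequent calculi -/

/-- A selection of the optional sequent rules. -/
structure RuleSet where
  hasC : Bool
  hasW : Bool
  hasKBox : Bool
  hasKDia : Bool
  hasKBot : Bool
  hasD : Bool
  hasCut : Bool

def RS.IMLL : RuleSet := ⟨false, false, false, false, false, false, false⟩
def RS.LI : RuleSet := ⟨true, true, false, false, false, false, false⟩
def RS.IMLL_CK : RuleSet := ⟨false, false, true, true, true, false, false⟩
def RS.IMLL_CD : RuleSet := ⟨false, false, true, true, false, true, false⟩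
def RS.LCK : RuleSet := ⟨true, true, true, true, false, false, false⟩
def RS.LCD : RuleSet := ⟨true, true, true, true, false, true, false⟩

def RuleSet.withCut (R : RuleSet) : RuleSet := { R with hasCut := true }

/-- Two-sided sequent derivability `Γ ⊢ A` from the rules selected in `R`
(`AX`, `⊃R`, `⊃L`, `∧R`, `∧L` are always available). -/
inductive Der (R : RuleSet) : Multiset MForm → MForm → Prop
  | ax (a : ℕ) : Der R {MForm.atom a} (MForm.atom a)
  | contr {Γ : Multiset MForm} {A B : MForm} :
      R.hasC = true → Der R (A ::ₘ A ::ₘ Γ) B → Der R (A ::ₘ Γ) B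
  | weak {Γ : Multiset MForm} {A B : MForm} :
      R.hasW = true → Der R Γ B → Der R (A ::ₘ Γ) B
  | impR {Γ : Multiset MForm} {A B : MForm} :
      Der R (A ::ₘ Γ) B → Der R Γ (A.imp B)
  | impL {Γ Δ : Multiset MForm} {A B C : MForm} :
      Der R Γ A → Der R (B ::ₘ Δ) C → Der R ((A.imp B) ::ₘ (Γ + Δ)) C
  | andR {Γ Δ : Multiset MForm} {A B : MForm} :
      Der R Γ A → Der R Δ B → Der R (Γ + Δ) (A.conj B)
  | andL {Γ : Multiset MForm} {A B C : MForm} :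
      Der R (A ::ₘ B ::ₘ Γ) C → Der R ((A.conj B) ::ₘ Γ) C
  | kbox {Γ : Multiset MForm} {A : MForm} :
      R.hasKBox = true → Der R Γ A → Der R (Γ.map MForm.box) (MForm.box A)
  | kdia {Γ : Multiset MForm} {A B : MForm} :
      R.hasKDia = true → Der R (A ::ₘ Γ) B →
      Der R ((MForm.dia A) ::ₘ Γ.map MForm.box) (MForm.dia B)
  | kbot {Γ : Multiset MForm} {A : MForm} :
      R.hasKBot = true → Der R Γ A →
      Der R (MForm.diaBot ::ₘ Γ.map MForm.box) (MForm.dia A)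
  | dRule {Γ : Multiset MForm} {A : MForm} :
      R.hasD = true → Der R Γ A → Der R (Γ.map MForm.box) (MForm.dia A)
  | cut {Γ Δ : Multiset MForm} {A B : MForm} :
      R.hasCut = true → Der R Γ A → Der R (A ::ₘ Δ) B → Der R (Γ + Δ) B

/-- `F` is provable in the system `R`, i.e. the sequent `⊢ F` is derivable. -/
def SeqProvable (R : RuleSet) (F : MForm) : Prop := Der R 0 F

/-! ### The Hilbert-style logics CK and CD -/

/-- Theorems of the (disjunction-free) constructive modal logic `CK`
(for `d = false`) resp. `CD` (for `d = true`): intuitionistic axioms for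
`⊃`, `∧`, the axioms `k1`, `k2` (and `d` when `d = true`), closed under
modus ponens and necessitation. -/
inductive Thm : Bool → MForm → Prop
  | axK {d : Bool} {A B : MForm} : Thm d (A.imp (B.imp A))
  | axS {d : Bool} {A B C : MForm} :
      Thm d ((A.imp (B.imp C)).imp ((A.imp B).imp (A.imp C)))
  | axAndI {d : Bool} {A B : MForm} : Thm d (A.imp (B.imp (A.conj B)))
  | axAnd1 {d : Bool} {A B : MForm} : Thm d ((A.conj B).imp A)
  | axAnd2 {d : Bool} {A B : MForm} : Thm d ((A.conj B).imp B)
  | axk1 {d : Bool} {A B : MForm} :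
      Thm d ((MForm.box (A.imp B)).imp ((MForm.box A).imp (MForm.box B)))
  | axk2 {d : Bool} {A B : MForm} :
      Thm d ((MForm.box (A.imp B)).imp ((MForm.dia A).imp (MForm.dia B)))
  | axD {A : MForm} : Thm true ((MForm.box A).imp (MForm.dia A))
  | mp {d : Bool} {A B : MForm} : Thm d (A.imp B) → Thm d A → Thm d B
  | nec {d : Bool} {A : MForm} : Thm d A → Thm d (MForm.box A)

/-! ### Polarized formulas -/

inductive Pol : Type
  | o  -- output polarity `°`
  | i  -- input polarity `•`
deriving DecidableEq

/-- Polarized formulas (`PForm Pol.o` are the `°`-formulas, `PForm Pol.i`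
the `•`-formulas). -/
inductive PForm : Pol → Type
  | atom (p : Pol) (a : ℕ) : PForm p
  | tens {p : Pol} : PForm p → PForm p → PForm p
  | limpO : PForm Pol.i → PForm Pol.o → PForm Pol.o
  | limpI : PForm Pol.o → PForm Pol.i → PForm Pol.i
  | box {p : Pol} : PForm p → PForm p
  | dia {p : Pol} : PForm p → PForm p
  | diaBot : PForm Pol.i

/-- `⌊H⌋`: erase polarities, replacing `⊗` by `∧` and `⊸` by `⊃`. -/
def PForm.floor : {p : Pol} → PForm p → MForm
  | _, .atom _ a => .atom a
  | _, .tens A B => .conj A.floor B.floor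
  | _, .limpO A B => .imp A.floor B.floor
  | _, .limpI A B => .imp A.floor B.floor
  | _, .box A => .box A.floor
  | _, .dia A => .dia A.floor
  | _, .diaBot => .diaBot

/-- One-sided polarized sequent derivability `Γ•, A°` from the rules
selected in `R` (the polarized versions of the two-sided rules). -/
inductive PDer (R : RuleSet) : Multiset (PForm Pol.i) → PForm Pol.o → Prop
  | ax (a : ℕ) : PDer R {PForm.atom Pol.i a} (PForm.atom Pol.o a)
  | contr {Γ : Multiset (PForm Pol.i)} {A : PForm Pol.i} {B : PForm Pol.o} :
      R.hasC = true → PDer R (A ::ₘ A ::ₘ Γ) B → PDer R (A ::ₘ Γ) B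
  | weak {Γ : Multiset (PForm Pol.i)} {A : PForm Pol.i} {B : PForm Pol.o} :
      R.hasW = true → PDer R Γ B → PDer R (A ::ₘ Γ) B
  | impO {Γ : Multiset (PForm Pol.i)} {A : PForm Pol.i} {B : PForm Pol.o} :
      PDer R (A ::ₘ Γ) B → PDer R Γ (PForm.limpO A B)
  | impI {Γ Δ : Multiset (PForm Pol.i)} {A : PForm Pol.o} {B : PForm Pol.i}
      {C : PForm Pol.o} :
      PDer R Γ A → PDer R (B ::ₘ Δ) C → PDer R ((PForm.limpI A B) ::ₘ (Γ + Δ)) C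
  | tensO {Γ Δ : Multiset (PForm Pol.i)} {A B : PForm Pol.o} :
      PDer R Γ A → PDer R Δ B → PDer R (Γ + Δ) (PForm.tens A B)
  | tensI {Γ : Multiset (PForm Pol.i)} {A B : PForm Pol.i} {C : PForm Pol.o} :
      PDer R (A ::ₘ B ::ₘ Γ) C → PDer R ((PForm.tens A B) ::ₘ Γ) C
  | kbox {Γ : Multiset (PForm Pol.i)} {A : PForm Pol.o} :
      R.hasKBox = true → PDer R Γ A → PDer R (Γ.map PForm.box) (PForm.box A)
  | kdia {Γ : Multiset (PForm Pol.i)} {A : PForm Pol.i} {B : PForm Pol.o} :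
      R.hasKDia = true → PDer R (A ::ₘ Γ) B →
      PDer R ((PForm.dia A) ::ₘ Γ.map PForm.box) (PForm.dia B)
  | kbot {Γ : Multiset (PForm Pol.i)} {A : PForm Pol.o} :
      R.hasKBot = true → PDer R Γ A →
      PDer R (PForm.diaBot ::ₘ Γ.map PForm.box) (PForm.dia A)
  | dRule {Γ : Multiset (PForm Pol.i)} {A : PForm Pol.o} :
      R.hasD = true → PDer R Γ A → PDer R (Γ.map PForm.box) (PForm.dia A)

/-- The P-formula `H` is provable in the polarized system `R`. -/
def PProvable (R : RuleSet) (H : PForm Pol.o) : Prop := PDer R 0 H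

/-! ### Deep inference rules `↓POL-LI` -/

/-- One step of deep rewriting with a rule of `↓POL-LI`
(`w◇`, `w⊗`, `w⊸`, deep `c•`), inside an arbitrary polarized context. -/
inductive DeepStep : {p : Pol} → PForm p → PForm p → Prop
  | wdia (A : PForm Pol.i) : DeepStep PForm.diaBot (PForm.dia A)
  | wtens (A B : PForm Pol.i) : DeepStep A (PForm.tens A B)
  | wlimp (A : PForm Pol.o) (B : PForm Pol.i) : DeepStep A (PForm.limpO B A)
  | ctr (A : PForm Pol.i) : DeepStep (PForm.tens A A) A
  | tensL {p : Pol} {A A' B : PForm p} :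
      DeepStep A A' → DeepStep (PForm.tens A B) (PForm.tens A' B)
  | tensR {p : Pol} {A B B' : PForm p} :
      DeepStep B B' → DeepStep (PForm.tens A B) (PForm.tens A B')
  | limpOL {A A' : PForm Pol.i} {B : PForm Pol.o} :
      DeepStep A A' → DeepStep (PForm.limpO A B) (PForm.limpO A' B)
  | limpOR {A : PForm Pol.i} {B B' : PForm Pol.o} :
      DeepStep B B' → DeepStep (PForm.limpO A B) (PForm.limpO A B')
  | limpIL {A A' : PForm Pol.o} {B : PForm Pol.i} :
      DeepStep A A' → DeepStep (PForm.limpI A B) (PForm.limpI A' B)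
  | limpIR {A : PForm Pol.o} {B B' : PForm Pol.i} :
      DeepStep B B' → DeepStep (PForm.limpI A B) (PForm.limpI A B')
  | boxC {p : Pol} {A A' : PForm p} :
      DeepStep A A' → DeepStep (PForm.box A) (PForm.box A')
  | diaC {p : Pol} {A A' : PForm p} :
      DeepStep A A' → DeepStep (PForm.dia A) (PForm.dia A')

/-- There is a derivation from `H'` to `H` using only rules of `↓POL-LI`. -/
def DeepDer (H' H : PForm Pol.o) : Prop :=
  Relation.ReflTransGen (@DeepStep Pol.o) H' H

/-! ### Labeled graphs -/

/-- The label set `L = 𝒜 ∪ {□, ◇}`. -/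
inductive MLabel : Type
  | atom : ℕ → MLabel
  | box : MLabel
  | dia : MLabel
deriving DecidableEq

/-- `pathN r n v w`: there is an `r`-path of length `n` from `v` to `w`. -/
def pathN {V : Type} (r : V → V → Prop) : ℕ → V → V → Prop
  | 0 => fun v w => v = w
  | n + 1 => fun v w => ∃ u, r v u ∧ pathN r n u w

/-- An `L`-labeled directed graph. -/
structure LDigraph where
  V : Type
  vfin : Finite V
  edge : V → V → Prop
  label : V → MLabel

/-- An arena: a nonempty `L`-labeled DAG which is L-free and Σ-free. -/
def LDigraph.IsArena (G : LDigraph) : Prop :=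
  Nonempty G.V ∧
  (∀ v, ¬ Relation.TransGen G.edge v v) ∧
  (∀ a u w v, G.edge a u → G.edge a w → G.edge w v → G.edge u v) ∧
  (∀ a v w b u, G.edge a v → G.edge a w → G.edge b w → G.edge b u →
    G.edge a u ∨ G.edge b v)

/-- Isomorphism of `L`-labeled directed graphs. -/
structure LDigraph.Iso (G H : LDigraph) where
  e : G.V ≃ H.V
  edge_iff : ∀ v w, G.edge v w ↔ H.edge (e v) (e w)
  label_eq : ∀ v, H.label (e v) = G.label v

/-- An `L`-labeled graph with two kinds of edges `→` (`iedge`) and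
`⇢` (`medge`). -/
structure LGraph where
  V : Type
  vfin : Finite V
  iedge : V → V → Prop
  medge : V → V → Prop
  label : V → MLabel

/-- Forget the `⇢`-edges. -/
def LGraph.toDigraph (G : LGraph) : LDigraph := ⟨G.V, G.vfin, G.iedge, G.label⟩

/-- `G` is a two-color DAG: the edge sets are disjoint and their union is
acyclic. -/
def LGraph.IsTwoColor (G : LGraph) : Prop :=
  (∀ v w, ¬ (G.iedge v w ∧ G.medge v w)) ∧
  (∀ v, ¬ Relation.TransGen (fun a b => G.iedge a b ∨ G.medge a b) v v)

def LGraph.iRoot (G : LGraph) (v : G.V) : Prop := ∀ w, ¬ G.iedge v w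

def LGraph.mRoot (G : LGraph) (v : G.V) : Prop := ∀ w, ¬ G.medge v w

def LGraph.istar (G : LGraph) : G.V → G.V → Prop := Relation.ReflTransGen G.iedge

/-- `(V, →)` is an arena. -/
def LGraph.IsArena (G : LGraph) : Prop :=
  Nonempty G.V ∧
  (∀ v, ¬ Relation.TransGen G.iedge v v) ∧
  (∀ a u w v, G.iedge a u → G.iedge a w → G.iedge w v → G.iedge u v) ∧
  (∀ a v w b u, G.iedge a v → G.iedge a w → G.iedge b w → G.iedge b u →
    G.iedge a u ∨ G.iedge b v)

/-- Modal arena. -/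
def LGraph.IsModalArena (G : LGraph) : Prop :=
  G.IsTwoColor ∧ G.IsArena ∧
  (∀ v w u, G.medge v w → G.medge w u → G.medge v u) ∧
  (∀ v w u, G.medge v w → G.medge u w → (G.medge u v ∨ G.medge v u ∨ u = v)) ∧
  (∀ v w u, G.medge v w → G.medge v u → ¬ G.iedge u w) ∧
  (∀ v w u, G.medge v w → G.iedge u v → G.iedge u w) ∧
  (∀ v w u, G.medge v w → G.iedge v u → G.iedge w u) ∧
  (∀ v w u, G.medge v w → G.iedge w u → G.iedge v u) ∧
  (∀ v w, G.medge v w → (G.label v = MLabel.box ∨ G.label v = MLabel.dia)) ∧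
  (∀ v, G.label v = MLabel.box → ∃ w, G.medge v w)

def LGraph.atomicV (G : LGraph) (v : G.V) : Prop := ∃ a, G.label v = MLabel.atom a

def LGraph.modalV (G : LGraph) (v : G.V) : Prop :=
  G.label v = MLabel.box ∨ G.label v = MLabel.dia

/-! ### Operations on labeled graphs and the translation `[[·]]` -/

def sumRel {A B : Type} (r : A → A → Prop) (s : B → B → Prop) :
    A ⊕ B → A ⊕ B → Prop
  | Sum.inl x, Sum.inl y => r x y
  | Sum.inr x, Sum.inr y => s x y
  | _, _ => False

/-- Disjoint union `G + H`. -/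
def LGraph.gsum (G H : LGraph) : LGraph where
  V := G.V ⊕ H.V
  vfin := by haveI := G.vfin; haveI := H.vfin; exact inferInstance
  iedge := sumRel G.iedge H.iedge
  medge := sumRel G.medge H.medge
  label := Sum.elim G.label H.label

/-- `G ▹ H`: disjoint union plus a `→`-edge from every `→`-root of `G` to
every `→`-root of `H`. -/
def LGraph.bef (G H : LGraph) : LGraph where
  V := G.V ⊕ H.V
  vfin := by haveI := G.vfin; haveI := H.vfin; exact inferInstance
  iedge := fun a b => sumRel G.iedge H.iedge a b ∨
    (∃ (x : G.V) (y : H.V), a = Sum.inl x ∧ b = Sum.inr y ∧ G.iRoot x ∧ H.iRoot y)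
  medge := sumRel G.medge H.medge
  label := Sum.elim G.label H.label

/-- `G ▹⇢ H`: disjoint union plus a `⇢`-edge from every `→`-root of `G` to
every `→`-root of `H`. -/
def LGraph.mbef (G H : LGraph) : LGraph where
  V := G.V ⊕ H.V
  vfin := by haveI := G.vfin; haveI := H.vfin; exact inferInstance
  iedge := sumRel G.iedge H.iedge
  medge := fun a b => sumRel G.medge H.medge a b ∨
    (∃ (x : G.V) (y : H.V), a = Sum.inl x ∧ b = Sum.inr y ∧ G.iRoot x ∧ H.iRoot y)
  label := Sum.elim G.label H.label

/-- The single-vertex graph with label `l`. -/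
def LGraph.single (l : MLabel) : LGraph where
  V := Unit
  vfin := inferInstance
  iedge := fun _ _ => False
  medge := fun _ _ => False
  label := fun _ => l

/-- The translation `[[·]]` from modal formulas to `L`-labeled two-color
DAGs. -/
def MForm.arena : MForm → LGraph
  | .atom a => LGraph.single (MLabel.atom a)
  | .diaBot => LGraph.single MLabel.dia
  | .conj A B => A.arena.gsum B.arena
  | .imp A B => A.arena.bef B.arena
  | .box A => (LGraph.single MLabel.box).mbef A.arena
  | .dia A => (LGraph.single MLabel.dia).mbef A.arena

/-- Isomorphism of `L`-labeled two-color DAGs. -/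
structure LGraph.Iso (G H : LGraph) where
  e : G.V ≃ H.V
  iedge_iff : ∀ v w, G.iedge v w ↔ H.iedge (e v) (e w)
  medge_iff : ∀ v w, G.medge v w ↔ H.medge (e v) (e w)
  label_eq : ∀ v, H.label (e v) = G.label v

/-! ### Depth, meeting points, skew fibrations -/

/-- The depth of `v`: the length of the longest `→`-path from `v` to a
`→`-root. -/
noncomputable def LGraph.depth (G : LGraph) (v : G.V) : ℕ :=
  sSup {n : ℕ | ∃ w, pathN G.iedge n v w ∧ G.iRoot w}

/-- `u` is a meeting point of `v` and `w`. -/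
def LGraph.IsMeet (G : LGraph) (v w u : G.V) : Prop :=
  G.istar v u ∧ G.istar w u ∧
  ∀ u', G.istar v u' → G.istar w u' → G.istar u u'

/-- `v` and `w` are conjunct: distinct, with odd meeting depth. -/
def LGraph.Conj (G : LGraph) (v w : G.V) : Prop :=
  v ≠ w ∧ ∃ u, G.IsMeet v w u ∧ ¬ Even (G.depth u) ∧
    ∀ u', G.IsMeet v w u' → G.depth u ≤ G.depth u'

/-- `v` and `w` are disjunct: distinct, with even meeting depth. -/
def LGraph.Disj (G : LGraph) (v w : G.V) : Prop :=
  v ≠ w ∧ ∃ u, G.IsMeet v w u ∧ Even (G.depth u) ∧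
    ∀ u', G.IsMeet v w u' → G.depth u ≤ G.depth u'

/-- Arena homomorphism: preserves `→`, `⇢`, depth and labels. -/
def IsHom (H G : LGraph) (f : H.V → G.V) : Prop :=
  (∀ v w, H.iedge v w → G.iedge (f v) (f w)) ∧
  (∀ v w, H.medge v w → G.medge (f v) (f w)) ∧
  (∀ v, H.depth v = G.depth (f v)) ∧
  (∀ v, H.label v = G.label (f v))

/-- Modal arena homomorphism. -/
def IsModalHom (H G : LGraph) (f : H.V → G.V) : Prop :=
  IsHom H G f ∧ ∀ v u, G.medge (f v) (f u) → ∃ w, H.medge w u ∧ f w = f v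

/-- (Even) skew fibration. -/
def IsSkewFib (H G : LGraph) (f : H.V → G.V) : Prop :=
  IsModalHom H G f ∧
  (∀ v w, H.Conj v w → G.Conj (f v) (f w)) ∧
  (∀ v w, G.Conj (f v) w → ∃ u, H.Conj v u ∧ ¬ G.Conj (f u) w)

/-- Odd skew fibration. -/
def IsOddSkewFib (H G : LGraph) (f : H.V → G.V) : Prop :=
  IsModalHom H G f ∧
  (∀ v w, H.Disj v w → G.Disj (f v) (f w)) ∧
  (∀ v w, G.Disj (f v) w → ∃ u, H.Disj v u ∧ ¬ G.Disj (f u) w)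

/-! ### Arena nets -/

/-- The `⇢`-cone of a modal vertex `m`. -/
def LGraph.mcone (G : LGraph) (m : G.V) : Set G.V :=
  {w | ∃ u, G.medge m u ∧ G.istar w u ∧ ¬ G.istar w m}

/-- `m` is the principal modal vertex of `v` (`m = p(v)`). -/
def LGraph.IsPrincipal (G : LGraph) (v m : G.V) : Prop :=
  (v ∈ G.mcone m ∧ ∀ m', v ∈ G.mcone m' → m' ≠ m → m ∈ G.mcone m') ∨
  (m = v ∧ ∀ m', v ∉ G.mcone m')

/-- The `→`-edge `v → w` is a chord. -/
def LGraph.IsChord (G : LGraph) (v w : G.V) : Prop :=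
  G.iedge v w ∧
  ((∃ u, G.iedge v u ∧ G.medge u w) ∨ (∃ u, G.iedge u w ∧ G.medge u v))

/-- `⤳o`: odd non-chord `→`-edges. -/
def LGraph.oE (G : LGraph) (v w : G.V) : Prop :=
  G.iedge v w ∧ ¬ Even (G.depth w) ∧ ¬ G.IsChord v w

/-- `⤳m`: edges `(v, p(v))` with `p(v) ≠ v` and `v` even or `p(v)` odd. -/
def LGraph.mE (G : LGraph) (v w : G.V) : Prop :=
  G.IsPrincipal v w ∧ w ≠ v ∧ (Even (G.depth v) ∨ ¬ Even (G.depth w))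

/-- `⤳≈`: from odd vertices to the even vertex of their `≈`-class. -/
def axE (G : LGraph) (ax : G.V → G.V → Prop) (v w : G.V) : Prop :=
  ¬ Even (G.depth v) ∧ Even (G.depth w) ∧ ax v w

/-- Edges of the linking graph `λ(G)`. -/
def lkE (G : LGraph) (ax : G.V → G.V → Prop) (v w : G.V) : Prop :=
  G.oE v w ∨ G.mE v w ∨ axE G ax v w

/-- Checked paths in the linking graph. -/
def Checked (G : LGraph) (ax : G.V → G.V → Prop) (p : List G.V) : Prop :=
  List.Chain' (lkE G ax) p ∧
  (∀ v, p.head? = some v → (G.iRoot v ∧ G.mRoot v)) ∧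
  List.Chain' (fun v w => axE G ax v w → G.mcone v = ∅) p

/-- `ax` makes `G` a partitioned modal arena. -/
def IsPartitioned (G : LGraph) (ax : G.V → G.V → Prop) : Prop :=
  Equivalence ax ∧
  (∀ v w, G.atomicV v → ax v w → (G.atomicV w ∧ G.label v = G.label w)) ∧
  (∀ v, G.atomicV v → ∃ w, w ≠ v ∧ ax v w ∧ ∀ u, ax v u → u = v ∨ u = w)

/-- Linked: every `≈`-class has exactly one even vertex. -/
def Linked (G : LGraph) (ax : G.V → G.V → Prop) : Prop :=
  ∀ v, ∃ w, ax v w ∧ Even (G.depth w) ∧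
    ∀ u, ax v u → Even (G.depth u) → u = w

def NetAcyclic (G : LGraph) (ax : G.V → G.V → Prop) : Prop :=
  ∀ p, Checked G ax p → p.Nodup

def NetFunctional (G : LGraph) (ax : G.V → G.V → Prop) : Prop :=
  ∀ p, Checked G ax p → ∀ v ∈ p, ¬ Even (G.depth v) →
    ∃ w ∈ p, Even (G.depth w) ∧ G.iedge v w

def NetFunctorial (G : LGraph) (ax : G.V → G.V → Prop) : Prop :=
  ∀ v w w', G.medge v w → ax w w' → ∃ v', ax v v' ∧ G.medge v' w'

/-- CK-arena net. -/
def IsCKNet (G : LGraph) (ax : G.V → G.V → Prop) : Prop :=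
  G.IsModalArena ∧ Nonempty G.V ∧ IsPartitioned G ax ∧ Linked G ax ∧
  NetAcyclic G ax ∧ NetFunctional G ax ∧ NetFunctorial G ax ∧
  (∀ v, G.modalV v → (∀ w, ¬ G.medge v w) → G.label v = MLabel.dia) ∧
  (∀ w, G.modalV w → Even (G.depth w) →
    ((∀ v, ax v w → G.label v = MLabel.box) ∨
     (G.label w = MLabel.dia ∧
       ∃! v, ax v w ∧ ¬ Even (G.depth v) ∧ G.label v = MLabel.dia)))

/-- CD-arena net. -/
def IsCDNet (G : LGraph) (ax : G.V → G.V → Prop) : Prop :=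
  G.IsModalArena ∧ Nonempty G.V ∧ IsPartitioned G ax ∧ Linked G ax ∧
  NetAcyclic G ax ∧ NetFunctional G ax ∧ NetFunctorial G ax ∧
  (∀ v, G.modalV v → ∃ w, G.medge v w) ∧
  (∀ w, G.modalV w → Even (G.depth w) →
    ((∀ v, ax v w → G.label v = MLabel.box) ∨
     (G.label w = MLabel.dia ∧
       ∀ v v', (ax v w ∧ ¬ Even (G.depth v) ∧ G.label v = MLabel.dia) →
               (ax v' w ∧ ¬ Even (G.depth v') ∧ G.label v' = MLabel.dia) →
               v = v')))

/-- `X`-arena net, `d = false` for `X = CK` and `d = true` for `X = CD`. -/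
def IsNet (d : Bool) (G : LGraph) (ax : G.V → G.V → Prop) : Prop :=
  if d then IsCDNet G ax else IsCKNet G ax

/-! ### Formula isomorphism -/

/-- The smallest congruence on modal formulas containing commutativity and
associativity of `∧` and currying. -/
inductive FEq : MForm → MForm → Prop
  | comm (A B : MForm) : FEq (A.conj B) (B.conj A)
  | assoc (A B C : MForm) : FEq (A.conj (B.conj C)) ((A.conj B).conj C)
  | curry (A B C : MForm) : FEq ((A.conj B).imp C) (A.imp (B.imp C))
  | refl (A : MForm) : FEq A A
  | symm {A B : MForm} : FEq A B → FEq B A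
  | trans {A B C : MForm} : FEq A B → FEq B C → FEq A C
  | impC {A A' B B' : MForm} : FEq A A' → FEq B B' → FEq (A.imp B) (A'.imp B')
  | conjC {A A' B B' : MForm} : FEq A A' → FEq B B' → FEq (A.conj B) (A'.conj B')
  | boxC {A A' : MForm} : FEq A A' → FEq (MForm.box A) (MForm.box A')
  | diaC {A A' : MForm} : FEq A A' → FEq (MForm.dia A) (MForm.dia A')

/-! ### Views and winning innocent strategies -/

/-- A view on a modal arena. -/
def IsView (G : LGraph) (p : List G.V) : Prop :=
  p.Nodup ∧
  (∀ v, p.head? = some v → G.iRoot v) ∧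
  (∀ i : Fin p.length, i.val ≠ 0 →
    ∃ j : Fin p.length, j.val < i.val ∧ G.iedge (p.get i) (p.get j)) ∧
  (∀ (i : ℕ) (h : i + 1 < p.length),
    (Even (G.depth (p.get ⟨i + 1, h⟩)) ∧
        ¬ Even (G.depth (p.get ⟨i, Nat.lt_of_succ_lt h⟩)) →
      G.iedge (p.get ⟨i + 1, h⟩) (p.get ⟨i, Nat.lt_of_succ_lt h⟩)) ∧
    (¬ Even (G.depth (p.get ⟨i + 1, h⟩)) ∧
        Even (G.depth (p.get ⟨i, Nat.lt_of_succ_lt h⟩)) →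
      G.label (p.get ⟨i + 1, h⟩) = G.label (p.get ⟨i, Nat.lt_of_succ_lt h⟩))) ∧
  (∀ v ∈ p, G.atomicV v ∨ G.label v = MLabel.dia)

/-- Winning innocent strategy on `G`. -/
def IsWIS (G : LGraph) (S : Set (List G.V)) : Prop :=
  S.Finite ∧
  (∀ p ∈ S, IsView G p) ∧
  (∀ p ∈ S, p.dropLast ∈ S) ∧
  (∀ p ∈ S, Even p.length → ∀ v, IsView G (p ++ [v]) → (p ++ [v]) ∈ S) ∧
  (∀ p ∈ S, ¬ Even p.length → ∃! v, (p ++ [v]) ∈ S) ∧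
  (∀ v, G.label v = MLabel.dia → Even (G.depth v) → (∃ p ∈ S, v ∈ p) →
    ((∃ w, G.medge v w) ∧ ∀ w, G.medge v w → ∃ q ∈ S, w ∈ q))

/-- Atomic strategy: all moves are labeled by propositional variables. -/
def AtomicWIS (G : LGraph) (S : Set (List G.V)) : Prop :=
  ∀ p ∈ S, ∀ v ∈ p, G.atomicV v

/-- `IsAddr G v l`: `l` is the address of `v`. -/
inductive IsAddr (G : LGraph) : G.V → List G.V → Prop
  | nil (v : G.V) : G.IsPrincipal v v → IsAddr G v []
  | cons {v m : G.V} {l : List G.V} :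
      G.IsPrincipal v m → m ≠ v → IsAddr G m l → IsAddr G v (m :: l)

/-- Well-framed view: consecutive moves `p_{2k}`, `p_{2k+1}` have addresses
of the same length. -/
def WellFramed (G : LGraph) (p : List G.V) : Prop :=
  ∀ (k : ℕ) (h : 2 * k + 1 < p.length) (l1 l2 : List G.V),
    IsAddr G (p.get ⟨2 * k, by omega⟩) l1 →
    IsAddr G (p.get ⟨2 * k + 1, h⟩) l2 → l1.length = l2.length

/-- A framed view of `p`: a choice of address and blank-height for each
column. -/
structure Framing (G : LGraph) (p : List G.V) where
  addr : Fin p.length → List G.V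
  addr_ok : ∀ i, IsAddr G (p.get i) (addr i)
  ht : Fin p.length → ℕ

/-- The entry of the framed view in column `i`, row `r`. -/
def frEntry {G : LGraph} {p : List G.V} (fr : Framing G p)
    (i : Fin p.length) (r : ℕ) : Option G.V :=
  if r = 0 then some (p.get i)
  else if r ≤ fr.ht i then none
  else (fr.addr i)[r - fr.ht i - 1]?

/-- Generating relation of `≈_p`: non-blank entries in the same row of
columns `2k` and `2k+1`. -/
def frRel {G : LGraph} {p : List G.V} (fr : Framing G p) (u w : G.V) : Prop :=
  ∃ (k r : ℕ) (h : 2 * k + 1 < p.length),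
    frEntry fr ⟨2 * k, by omega⟩ r = some u ∧ frEntry fr ⟨2 * k + 1, h⟩ r = some w

/-- Equivalence generated by a relation. -/
inductive REqvGen {V : Type} (r : V → V → Prop) : V → V → Prop
  | rel {x y : V} : r x y → REqvGen r x y
  | refl (x : V) : REqvGen r x x
  | symm {x y : V} : REqvGen r x y → REqvGen r y x
  | trans {x y z : V} : REqvGen r x y → REqvGen r y z → REqvGen r x z

/-- The equivalence relation `≈_p` induced by a framed view. -/
def frEq {G : LGraph} {p : List G.V} (fr : Framing G p) : G.V → G.V → Prop :=
  REqvGen (frRel fr)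

/-- A vertex is involved in a framed view if it occurs among its entries. -/
def frInv {G : LGraph} {p : List G.V} (fr : Framing G p) (v : G.V) : Prop :=
  ∃ (i : Fin p.length) (r : ℕ), frEntry fr i r = some v

/-- CK-WIS: a well-framed linked WIS satisfying the CK frame conditions. -/
def IsCKWIS (G : LGraph) (S : Set (List G.V)) : Prop :=
  IsWIS G S ∧ (∀ p ∈ S, WellFramed G p) ∧
  ∃ fr : ∀ p, p ∈ S → Framing G p,
    (∀ p (h : p ∈ S), ∀ v, frInv (fr p h) v →
      ∃ w, frEq (fr p h) v w ∧ Even (G.depth w) ∧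
        ∀ u, frEq (fr p h) v u → Even (G.depth u) → u = w) ∧
    (∀ w, G.modalV w → Even (G.depth w) → (∃ p h, frInv (fr p h) w) →
      ((G.label w = MLabel.box →
        ∀ v, (¬ Even (G.depth v) ∧ Even (G.depth w) ∧ ∃ p h, frEq (fr p h) v w) →
          G.label v = MLabel.box) ∧
       (G.label w = MLabel.dia →
        ∃! v, (¬ Even (G.depth v) ∧ Even (G.depth w) ∧ ∃ p h, frEq (fr p h) v w) ∧
          G.label v = MLabel.dia)))

/-- CD-WIS: a well-framed linked atomic WIS satisfying the CD frame
conditions. -/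
def IsCDWIS (G : LGraph) (S : Set (List G.V)) : Prop :=
  IsWIS G S ∧ AtomicWIS G S ∧ (∀ p ∈ S, WellFramed G p) ∧
  ∃ fr : ∀ p, p ∈ S → Framing G p,
    (∀ p (h : p ∈ S), ∀ v, frInv (fr p h) v →
      ∃ w, frEq (fr p h) v w ∧ Even (G.depth w) ∧
        ∀ u, frEq (fr p h) v u → Even (G.depth u) → u = w) ∧
    (∀ w, G.modalV w → Even (G.depth w) → (∃ p h, frInv (fr p h) w) →
      ((G.label w = MLabel.box →
        ∀ v, (¬ Even (G.depth v) ∧ Even (G.depth w) ∧ ∃ p h, frEq (fr p h) v w) →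
          G.label v = MLabel.box) ∧
       (G.label w = MLabel.dia →
        ∀ v v',
          ((¬ Even (G.depth v) ∧ Even (G.depth w) ∧ ∃ p h, frEq (fr p h) v w) ∧
            G.label v = MLabel.dia) →
          ((¬ Even (G.depth v') ∧ Even (G.depth w) ∧ ∃ p h, frEq (fr p h) v' w) ∧
            G.label v' = MLabel.dia) → v = v')))

/-- `X`-WIS, `d = false` for `X = CK` and `d = true` for `X = CD`. -/
def IsXWIS (d : Bool) (G : LGraph) (S : Set (List G.V)) : Prop :=
  if d then IsCDWIS G S else IsCKWIS G S

/-! ### Abstract views of an arena net -/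

def LGraph.isAtomB (G : LGraph) (v : G.V) : Bool :=
  match G.label v with
  | MLabel.atom _ => true
  | _ => false

/-- `⌊s⌋`: the subsequence of atomic vertices of `s`. -/
def atomFilter (G : LGraph) (s : List G.V) : List G.V := s.filter G.isAtomB

/-- `Abs G ax s q`: `q` is an abstract view obtained from the framed
abstract view `s`. -/
inductive Abs (G : LGraph) (ax : G.V → G.V → Prop) : List G.V → List G.V → Prop
  | base (s : List G.V) : Abs G ax s (atomFilter G s)
  | pair (s1 : List G.V) (v w : G.V) (s2 rest q : List G.V) :
      G.label v = MLabel.dia → G.label w = MLabel.dia → axE G ax v w →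
      Abs G ax rest q →
      Abs G ax (s1 ++ v :: (s2 ++ w :: rest)) (atomFilter G s1 ++ v :: w :: q)

/-- Abstract views of the arena net `(G, ax)`: abstractions of framed
abstract views, i.e. of reversed checked paths of `λ(G)`. -/
def IsAbsView (G : LGraph) (ax : G.V → G.V → Prop) (q : List G.V) : Prop :=
  ∃ s : List G.V, Checked G ax s.reverse ∧ Abs G ax s q

/-! ### Forms of skew fibrations -/

/-- `f` is (up to isomorphism) an identity `id_G`. -/
def FormIdF (H G : LGraph) (f : H.V → G.V) : Prop :=
  ∃ e : LGraph.Iso H G, ∀ v, f v = e.e v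

/-- `f` is (up to isomorphism) of the form `f1 + f2`. -/
def FormSum (P Q : ∀ (H G : LGraph), (H.V → G.V) → Prop)
    (H G : LGraph) (f : H.V → G.V) : Prop :=
  ∃ (H1 H2 G1 G2 : LGraph) (f1 : H1.V → G1.V) (f2 : H2.V → G2.V),
    P H1 G1 f1 ∧ Q H2 G2 f2 ∧
    ∃ (eH : LGraph.Iso H (H1.gsum H2)) (eG : LGraph.Iso G (G1.gsum G2)),
      ∀ v, eG.e (f v) = Sum.map f1 f2 (eH.e v)

/-- `f` is (up to isomorphism) of the form `f1 ▹ f2`. -/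
def FormBef (P Q : ∀ (H G : LGraph), (H.V → G.V) → Prop)
    (H G : LGraph) (f : H.V → G.V) : Prop :=
  ∃ (H1 H2 G1 G2 : LGraph) (f1 : H1.V → G1.V) (f2 : H2.V → G2.V),
    P H1 G1 f1 ∧ Q H2 G2 f2 ∧
    ∃ (eH : LGraph.Iso H (H1.bef H2)) (eG : LGraph.Iso G (G1.bef G2)),
      ∀ v, eG.e (f v) = Sum.map f1 f2 (eH.e v)

/-- `f` is (up to isomorphism) of the form `id_v ▹⇢ f2` for a single modal
vertex `v`. -/
def FormMBef (Q : ∀ (H G : LGraph), (H.V → G.V) → Prop)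
    (H G : LGraph) (f : H.V → G.V) : Prop :=
  ∃ l : MLabel, (l = MLabel.box ∨ l = MLabel.dia) ∧
    ∃ (H2 G2 : LGraph) (f2 : H2.V → G2.V), Q H2 G2 f2 ∧
      ∃ (eH : LGraph.Iso H ((LGraph.single l).mbef H2))
        (eG : LGraph.Iso G ((LGraph.single l).mbef G2)),
        ∀ v, eG.e (f v) = Sum.map id f2 (eH.e v)

/-- `f` is (up to isomorphism) a pairing `⟨f1, f2⟩` into a common target. -/
def FormPair (P Q : ∀ (H G : LGraph), (H.V → G.V) → Prop)
    (H G : LGraph) (f : H.V → G.V) : Prop :=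
  ∃ (H1 H2 : LGraph) (f1 : H1.V → G.V) (f2 : H2.V → G.V),
    P H1 G f1 ∧ Q H2 G f2 ∧
    ∃ eH : LGraph.Iso H (H1.gsum H2), ∀ v, f v = Sum.elim f1 f2 (eH.e v)

namespace LGraph

/-! ### Basic facts on isomorphisms -/

def Iso.refl (G : LGraph) : Iso G G :=
  ⟨Equiv.refl _, fun _ _ => Iff.rfl, fun _ _ => Iff.rfl, fun _ => rfl⟩

def Iso.symm {G H : LGraph} (f : Iso G H) : Iso H G where
  e := f.e.symm
  iedge_iff v w := by simp [f.iedge_iff]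
  medge_iff v w := by simp [f.medge_iff]
  label_eq v := by simp [← f.label_eq]

def Iso.trans {G H K : LGraph} (f : Iso G H) (g : Iso H K) : Iso G K where
  e := f.e.trans g.e
  iedge_iff v w := by simp [f.iedge_iff, g.iedge_iff]
  medge_iff v w := by simp [f.medge_iff, g.medge_iff]
  label_eq v := by simp [f.label_eq, g.label_eq]

theorem Iso.iRoot_iff {G H : LGraph} (f : Iso G H) (v : G.V) :
    G.iRoot v ↔ H.iRoot (f.e v) := by
  simp only [iRoot, f.e.surjective.forall, f.iedge_iff]

theorem Iso.istar {G H : LGraph} (f : Iso G H) {v w : G.V} (h : G.istar v w) :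
    H.istar (f.e v) (f.e w) :=
  Relation.ReflTransGen.lift f.e (fun a b => (f.iedge_iff a b).1) _ _ h

/-! ### Roots and connectedness -/

/-- Every vertex has a `→`-path to a `→`-root. -/
def Rooted (G : LGraph) : Prop := ∀ v, ∃ w, G.istar v w ∧ G.iRoot w

/-- Every edge-invariant predicate is constant. -/
def Connected (G : LGraph) : Prop :=
  ∀ P : G.V → Prop, (∀ x y, G.iedge x y ∨ G.medge x y → (P x ↔ P y)) →
    ∀ x y, P x → P y

/-- `v` has a `→`-edge to every `→`-root. -/
def Dominates (G : LGraph) (v : G.V) : Prop := ∀ r, G.iRoot r → G.iedge v r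

theorem Iso.dominates_iff {G H : LGraph} (f : Iso G H) (v : G.V) :
    G.Dominates v ↔ H.Dominates (f.e v) := by
  simp only [Dominates, f.e.surjective.forall, f.iedge_iff, f.iRoot_iff]

theorem Iso.connected {G H : LGraph} (f : Iso G H) (h : G.Connected) : H.Connected := by
  intro P hP x y hx
  have := h (fun v => P (f.e v))
    (fun a b hab => hP _ _ (by rwa [← f.iedge_iff, ← f.medge_iff])) (f.e.symm x) (f.e.symm y)
  simpa using this (by simpa using hx)

theorem iff_of_istar {G : LGraph} {P : G.V → Prop}
    (hP : ∀ x y, G.iedge x y → (P x ↔ P y)) {x y : G.V} (h : G.istar x y) : P x ↔ P y := by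
  induction h with
  | refl => rfl
  | tail _ h ih => exact ih.trans (hP _ _ h)

section Operations

variable {G H G' H' : LGraph}

theorem gsum_iRoot_inl {x : G.V} : (G.gsum H).iRoot (Sum.inl x) ↔ G.iRoot x :=
  ⟨fun h w hw => h (Sum.inl w) hw, fun h w hw => by
    rcases w with w | w
    · exact h w hw
    · exact hw⟩

theorem gsum_iRoot_inr {y : H.V} : (G.gsum H).iRoot (Sum.inr y) ↔ H.iRoot y :=
  ⟨fun h w hw => h (Sum.inr w) hw, fun h w hw => by
    rcases w with w | w
    · exact hw
    · exact h w hw⟩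

theorem mbef_iRoot_inl {x : G.V} : (G.mbef H).iRoot (Sum.inl x) ↔ G.iRoot x :=
  gsum_iRoot_inl

theorem mbef_iRoot_inr {y : H.V} : (G.mbef H).iRoot (Sum.inr y) ↔ H.iRoot y :=
  gsum_iRoot_inr

theorem bef_iedge_inl_inl {x y : G.V} :
    (G.bef H).iedge (Sum.inl x) (Sum.inl y) ↔ G.iedge x y := by
  simp [bef, sumRel]

theorem bef_iedge_inr_inr {x y : H.V} :
    (G.bef H).iedge (Sum.inr x) (Sum.inr y) ↔ H.iedge x y := by
  simp [bef, sumRel]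

theorem bef_iedge_inl_inr {x : G.V} {y : H.V} :
    (G.bef H).iedge (Sum.inl x) (Sum.inr y) ↔ G.iRoot x ∧ H.iRoot y := by
  simp [bef, sumRel]

theorem bef_iedge_inr_inl {x : G.V} {y : H.V} :
    ¬ (G.bef H).iedge (Sum.inr y) (Sum.inl x) := by
  simp [bef, sumRel]

theorem mbef_medge_inl_inl {x y : G.V} :
    (G.mbef H).medge (Sum.inl x) (Sum.inl y) ↔ G.medge x y := by
  simp [mbef, sumRel]

theorem mbef_medge_inr_inr {x y : H.V} :
    (G.mbef H).medge (Sum.inr x) (Sum.inr y) ↔ H.medge x y := by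
  simp [mbef, sumRel]

theorem mbef_medge_inl_inr {x : G.V} {y : H.V} :
    (G.mbef H).medge (Sum.inl x) (Sum.inr y) ↔ G.iRoot x ∧ H.iRoot y := by
  simp [mbef, sumRel]

theorem mbef_medge_inr_inl {x : G.V} {y : H.V} :
    ¬ (G.mbef H).medge (Sum.inr y) (Sum.inl x) := by
  simp [mbef, sumRel]

theorem bef_iRoot_inr {y : H.V} : (G.bef H).iRoot (Sum.inr y) ↔ H.iRoot y :=
  ⟨fun h w hw => h (Sum.inr w) (bef_iedge_inr_inr.2 hw), fun h w hw => by
    rcases w with w | w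
    · exact bef_iedge_inr_inl hw
    · exact h w (bef_iedge_inr_inr.1 hw)⟩

theorem bef_not_iRoot_inl (hH : ∃ y, H.iRoot y) {x : G.V} :
    ¬ (G.bef H).iRoot (Sum.inl x) := by
  obtain ⟨y, hy⟩ := hH
  intro h
  have hx : G.iRoot x := fun w hw => h (Sum.inl w) (bef_iedge_inl_inl.2 hw)
  exact h (Sum.inr y) (bef_iedge_inl_inr.2 ⟨hx, hy⟩)

theorem bef_istar_inl {x y : G.V} (h : G.istar x y) :
    (G.bef H).istar (Sum.inl x) (Sum.inl y) :=
  Relation.ReflTransGen.lift (Sum.inl : G.V → (G.bef H).V)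
    (fun _ _ => bef_iedge_inl_inl.2) _ _ h

theorem bef_istar_inr {x y : H.V} (h : H.istar x y) :
    (G.bef H).istar (Sum.inr x) (Sum.inr y) :=
  Relation.ReflTransGen.lift (Sum.inr : H.V → (G.bef H).V)
    (fun _ _ => bef_iedge_inr_inr.2) _ _ h

theorem bef_istar_inr_right {x : H.V} {w : (G.bef H).V}
    (h : (G.bef H).istar (Sum.inr x) w) : ∃ z, w = Sum.inr z := by
  induction h with
  | refl => exact ⟨x, rfl⟩
  | @tail b c _ hbc ih =>
    obtain ⟨z, rfl⟩ := ih
    rcases c with c | c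
    · exact absurd hbc bef_iedge_inr_inl
    · exact ⟨c, rfl⟩

theorem gsum_istar_inl {x y : G.V} (h : G.istar x y) :
    (G.gsum H).istar (Sum.inl x) (Sum.inl y) :=
  Relation.ReflTransGen.lift (Sum.inl : G.V → (G.gsum H).V) (fun _ _ hab => hab) _ _ h

theorem gsum_istar_inr {x y : H.V} (h : H.istar x y) :
    (G.gsum H).istar (Sum.inr x) (Sum.inr y) :=
  Relation.ReflTransGen.lift (Sum.inr : H.V → (G.gsum H).V) (fun _ _ hab => hab) _ _ h

theorem Rooted.gsum (hG : G.Rooted) (hH : H.Rooted) : (G.gsum H).Rooted := by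
  rintro (v | v)
  · obtain ⟨w, h, hw⟩ := hG v
    exact ⟨Sum.inl w, gsum_istar_inl h, gsum_iRoot_inl.2 hw⟩
  · obtain ⟨w, h, hw⟩ := hH v
    exact ⟨Sum.inr w, gsum_istar_inr h, gsum_iRoot_inr.2 hw⟩

theorem Rooted.mbef (hG : G.Rooted) (hH : H.Rooted) : (G.mbef H).Rooted :=
  hG.gsum hH

theorem Rooted.bef (hG : G.Rooted) (hH : H.Rooted) (hne : ∃ y, H.iRoot y) :
    (G.bef H).Rooted := by
  rintro (v | v)
  · obtain ⟨w, h, hw⟩ := hG v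
    obtain ⟨y, hy⟩ := hne
    exact ⟨Sum.inr y, (bef_istar_inl h).tail (bef_iedge_inl_inr.2 ⟨hw, hy⟩),
      bef_iRoot_inr.2 hy⟩
  · obtain ⟨w, h, hw⟩ := hH v
    exact ⟨Sum.inr w, bef_istar_inr h, bef_iRoot_inr.2 hw⟩

theorem connected_single (l : MLabel) : (single l).Connected :=
  fun _ _ _ _ h => h

theorem connected_bef (hG : G.Rooted) (hH : H.Rooted) (hGne : ∃ x, G.iRoot x)
    (hHne : ∃ y, H.iRoot y) : (G.bef H).Connected := by
  intro P hP
  obtain ⟨a, ha⟩ := hGne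
  obtain ⟨b, hb⟩ := hHne
  have edge := fun x y h => hP x y (Or.inl h)
  have key : ∀ x, P x ↔ P (Sum.inr b) := by
    rintro (x | y)
    · obtain ⟨w, h, hw⟩ := hG x
      exact (iff_of_istar edge (bef_istar_inl h)).trans
        (edge _ _ (bef_iedge_inl_inr.2 ⟨hw, hb⟩))
    · obtain ⟨w, h, hw⟩ := hH y
      exact ((iff_of_istar edge (bef_istar_inr h)).trans
        (edge _ _ (bef_iedge_inl_inr.2 ⟨ha, hw⟩)).symm).trans
        (edge _ _ (bef_iedge_inl_inr.2 ⟨ha, hb⟩))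
  exact fun x y hx => (key y).2 ((key x).1 hx)

theorem connected_mbef (l : MLabel) (hH : H.Rooted) : ((single l).mbef H).Connected := by
  intro P hP
  have edge := fun x y h => hP x y (Or.inl h)
  have key : ∀ x, P x ↔ P (Sum.inl ()) := by
    rintro (⟨⟩ | y)
    · rfl
    · obtain ⟨w, h, hw⟩ := hH y
      exact (iff_of_istar edge (gsum_istar_inr h)).trans
        (hP _ _ (Or.inr (mbef_medge_inl_inr.2 ⟨fun _ h => h, hw⟩))).symm
  exact fun x y hx => (key y).2 ((key x).1 hx)

theorem not_connected_gsum (x : G.V) (y : H.V) : ¬ (G.gsum H).Connected := by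
  intro h
  have := h (fun v => v.isLeft = true) (by
    rintro (a | a) (b | b) hab <;> simp_all [gsum, sumRel]) (Sum.inl x) (Sum.inr y) rfl
  simp at this

/-! ### Congruence of the operations -/

def Iso.gsum (f : Iso G G') (g : Iso H H') : Iso (G.gsum H) (G'.gsum H') where
  e := Equiv.sumCongr f.e g.e
  iedge_iff := by
    rintro (v | v) (w | w)
    exacts [f.iedge_iff v w, Iff.rfl, Iff.rfl, g.iedge_iff v w]
  medge_iff := by
    rintro (v | v) (w | w)
    exacts [f.medge_iff v w, Iff.rfl, Iff.rfl, g.medge_iff v w]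
  label_eq := by
    rintro (v | v)
    exacts [f.label_eq v, g.label_eq v]

def Iso.mbef (f : Iso G G') (g : Iso H H') : Iso (G.mbef H) (G'.mbef H') where
  e := Equiv.sumCongr f.e g.e
  iedge_iff := (f.gsum g).iedge_iff
  medge_iff := by
    rintro (v | v) (w | w)
    · exact mbef_medge_inl_inl.trans ((f.medge_iff v w).trans mbef_medge_inl_inl.symm)
    · exact mbef_medge_inl_inr.trans
        ((and_congr (f.iRoot_iff v) (g.iRoot_iff w)).trans mbef_medge_inl_inr.symm)
    · exact iff_of_false mbef_medge_inr_inl mbef_medge_inr_inl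
    · exact mbef_medge_inr_inr.trans ((g.medge_iff v w).trans mbef_medge_inr_inr.symm)
  label_eq := (f.gsum g).label_eq

def Iso.bef (f : Iso G G') (g : Iso H H') : Iso (G.bef H) (G'.bef H') where
  e := Equiv.sumCongr f.e g.e
  iedge_iff := by
    rintro (v | v) (w | w)
    · exact bef_iedge_inl_inl.trans ((f.iedge_iff v w).trans bef_iedge_inl_inl.symm)
    · exact bef_iedge_inl_inr.trans
        ((and_congr (f.iRoot_iff v) (g.iRoot_iff w)).trans bef_iedge_inl_inr.symm)
    · exact iff_of_false bef_iedge_inr_inl bef_iedge_inr_inl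
    · exact bef_iedge_inr_inr.trans ((g.iedge_iff v w).trans bef_iedge_inr_inr.symm)
  medge_iff := (f.gsum g).medge_iff
  label_eq := (f.gsum g).label_eq

def Iso.gsumComm (G H : LGraph) : Iso (G.gsum H) (H.gsum G) where
  e := Equiv.sumComm _ _
  iedge_iff := by rintro (v | v) (w | w) <;> rfl
  medge_iff := by rintro (v | v) (w | w) <;> rfl
  label_eq := by rintro (v | v) <;> rfl

def Iso.gsumAssoc (G H K : LGraph) : Iso ((G.gsum H).gsum K) (G.gsum (H.gsum K)) where
  e := Equiv.sumAssoc _ _ _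
  iedge_iff := by rintro ((v | v) | v) ((w | w) | w) <;> rfl
  medge_iff := by rintro ((v | v) | v) ((w | w) | w) <;> rfl
  label_eq := by rintro ((v | v) | v) <;> rfl

def Iso.curry (G H K : LGraph) (hK : ∃ y, K.iRoot y) :
    Iso ((G.gsum H).bef K) (G.bef (H.bef K)) where
  e := Equiv.sumAssoc _ _ _
  iedge_iff := by
    rintro ((v | v) | v) ((w | w) | w)
    · exact bef_iedge_inl_inl.trans
        (bef_iedge_inl_inl (G := G) (H := H.bef K) (x := v) (y := w)).symm
    · exact bef_iedge_inl_inl.trans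
        ⟨False.elim, fun h => bef_not_iRoot_inl hK (bef_iedge_inl_inr.1 h).2⟩
    · exact bef_iedge_inl_inr.trans
        ((and_congr gsum_iRoot_inl bef_iRoot_inr.symm).trans bef_iedge_inl_inr.symm)
    · exact bef_iedge_inl_inl.trans ⟨False.elim, fun h => bef_iedge_inr_inl h⟩
    · exact bef_iedge_inl_inl.trans
        ((bef_iedge_inl_inl (G := H) (H := K) (x := v) (y := w)).symm.trans
          bef_iedge_inr_inr.symm)
    · exact bef_iedge_inl_inr.trans ((and_congr_left' gsum_iRoot_inr).trans
        (bef_iedge_inl_inr.symm.trans bef_iedge_inr_inr.symm))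
    · exact iff_of_false bef_iedge_inr_inl bef_iedge_inr_inl
    · exact iff_of_false bef_iedge_inr_inl
        fun h => bef_iedge_inr_inl (bef_iedge_inr_inr.1 h)
    · exact bef_iedge_inr_inr.trans (bef_iedge_inr_inr.symm.trans bef_iedge_inr_inr.symm)
  medge_iff := (Iso.gsumAssoc G H K).medge_iff
  label_eq := (Iso.gsumAssoc G H K).label_eq

/-! ### Splitting isomorphisms -/

theorem exists_sumCongr {A B C D : Type} (e : A ⊕ B ≃ C ⊕ D)
    (h : ∀ x, (e x).isLeft = x.isLeft) :
    ∃ (f : A ≃ C) (g : B ≃ D), e = Equiv.sumCongr f g := by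
  have h' : ∀ y, (e.symm y).isLeft = y.isLeft := fun y => by
    simpa using (h (e.symm y)).symm
  have hright : ∀ {X Y : Type} {z : X ⊕ Y}, z.isLeft = false → ∃ y, z = Sum.inr y := by
    rintro X Y (z | z) hz
    · cases hz
    · exact ⟨z, rfl⟩
  have hl : ∀ a, ∃ c, e (Sum.inl a) = Sum.inl c := fun a => Sum.isLeft_iff.1 (h _)
  have hr : ∀ b, ∃ d, e (Sum.inr b) = Sum.inr d := fun b => hright (h (Sum.inr b))
  have hl' : ∀ c, ∃ a, e.symm (Sum.inl c) = Sum.inl a := fun c => Sum.isLeft_iff.1 (h' _)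
  have hr' : ∀ d, ∃ b, e.symm (Sum.inr d) = Sum.inr b := fun d => hright (h' (Sum.inr d))
  choose f hf using hl
  choose g hg using hr
  choose f' hf' using hl'
  choose g' hg' using hr'
  refine ⟨⟨f, f', fun a => ?_, fun c => ?_⟩, ⟨g, g', fun b => ?_, fun d => ?_⟩, ?_⟩
  · exact Sum.inl_injective (β := B) (by rw [← hf', ← hf, e.symm_apply_apply])
  · exact Sum.inl_injective (β := D) (by rw [← hf, ← hf', e.apply_symm_apply])
  · exact Sum.inr_injective (α := A) (by rw [← hg', ← hg, e.symm_apply_apply])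
  · exact Sum.inr_injective (α := C) (by rw [← hg, ← hg', e.apply_symm_apply])
  · ext (a | b)
    · simp [hf]
    · simp [hg]

theorem isLeft_eq_isLeft {A B C D : Type} (e : A ⊕ B ≃ C ⊕ D)
    (h : ∀ a, (e (Sum.inl a)).isLeft) (h' : ∀ c, (e.symm (Sum.inl c)).isLeft) (x : A ⊕ B) :
    (e x).isLeft = x.isLeft := by
  rcases x with a | b
  · exact h a
  · rcases hb : e (Sum.inr b) with c | d
    · have := h' c
      rw [← hb, e.symm_apply_apply] at this
      cases this
    · rfl

theorem Iso.split_gsum (f : Iso (G.gsum H) (G'.gsum H'))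
    (h : ∀ x, (f.e x).isLeft = x.isLeft) : Nonempty (Iso G G') ∧ Nonempty (Iso H H') := by
  obtain ⟨e, hi, hm, hl⟩ := f
  obtain ⟨e₁, e₂, rfl⟩ := exists_sumCongr e h
  exact ⟨⟨⟨e₁, fun v w => hi (Sum.inl v) (Sum.inl w), fun v w => hm (Sum.inl v) (Sum.inl w),
    fun v => hl (Sum.inl v)⟩⟩, ⟨⟨e₂, fun v w => hi (Sum.inr v) (Sum.inr w),
    fun v w => hm (Sum.inr v) (Sum.inr w), fun v => hl (Sum.inr v)⟩⟩⟩

theorem Iso.split_bef (f : Iso (G.bef H) (G'.bef H'))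
    (h : ∀ x, (f.e x).isLeft = x.isLeft) : Nonempty (Iso G G') ∧ Nonempty (Iso H H') := by
  obtain ⟨e, hi, hm, hl⟩ := f
  obtain ⟨e₁, e₂, rfl⟩ := exists_sumCongr e h
  exact ⟨⟨⟨e₁, fun v w => bef_iedge_inl_inl.symm.trans
      ((hi (Sum.inl v) (Sum.inl w)).trans bef_iedge_inl_inl),
      fun v w => hm (Sum.inl v) (Sum.inl w), fun v => hl (Sum.inl v)⟩⟩,
    ⟨⟨e₂, fun v w => bef_iedge_inr_inr.symm.trans
      ((hi (Sum.inr v) (Sum.inr w)).trans bef_iedge_inr_inr),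
      fun v w => hm (Sum.inr v) (Sum.inr w), fun v => hl (Sum.inr v)⟩⟩⟩

theorem Iso.split_mbef (f : Iso (G.mbef H) (G'.mbef H'))
    (h : ∀ x, (f.e x).isLeft = x.isLeft) : Nonempty (Iso G G') ∧ Nonempty (Iso H H') := by
  obtain ⟨e, hi, hm, hl⟩ := f
  obtain ⟨e₁, e₂, rfl⟩ := exists_sumCongr e h
  exact ⟨⟨⟨e₁, fun v w => hi (Sum.inl v) (Sum.inl w), fun v w => mbef_medge_inl_inl.symm.trans
      ((hm (Sum.inl v) (Sum.inl w)).trans mbef_medge_inl_inl), fun v => hl (Sum.inl v)⟩⟩,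
    ⟨⟨e₂, fun v w => hi (Sum.inr v) (Sum.inr w), fun v w => mbef_medge_inr_inr.symm.trans
      ((hm (Sum.inr v) (Sum.inr w)).trans mbef_medge_inr_inr), fun v => hl (Sum.inr v)⟩⟩⟩

theorem Iso.isLeft_of_connected (f : Iso (G.gsum H) (G'.gsum H')) (hG : G.Connected)
    {x : G.V} (hx : (f.e (Sum.inl x)).isLeft) (y : G.V) : (f.e (Sum.inl y)).isLeft := by
  have side : ∀ a b, (G'.gsum H').iedge a b ∨ (G'.gsum H').medge a b →
      (a.isLeft = true ↔ b.isLeft = true) := by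
    rintro (a | a) (b | b) hab <;> simp_all [LGraph.gsum, sumRel]
  refine hG (fun z => (f.e (Sum.inl z)).isLeft = true) (fun a b hab => side _ _ ?_) x y hx
  exact hab.imp (f.iedge_iff (Sum.inl a) (Sum.inl b)).1 (f.medge_iff (Sum.inl a) (Sum.inl b)).1

/-- An isomorphism of sums matching a connected left summand with a connected left summand. -/
theorem Iso.cancel_gsum (f : Iso (G.gsum H) (G'.gsum H')) (hG : G.Connected)
    (hG' : G'.Connected) {x : G.V} {x' : G'.V} (hx : f.e (Sum.inl x) = Sum.inl x') :
    Nonempty (Iso G G') ∧ Nonempty (Iso H H') := by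
  have hx' : f.symm.e (Sum.inl x') = Sum.inl x :=
    (congrArg f.e.symm hx).symm.trans (f.e.symm_apply_apply _)
  exact f.split_gsum (isLeft_eq_isLeft f.e
    (f.isLeft_of_connected hG (x := x) (by rw [hx]; rfl))
    (f.symm.isLeft_of_connected hG' (x := x') (by rw [hx']; rfl)))

/-- An isomorphism of the graphs of implications whose conclusions have no dominating vertex. -/
theorem Iso.cancel_bef (f : Iso (G.bef H) (G'.bef H')) (hG : G.Rooted) (hG' : G'.Rooted)
    (hr : ∃ y, H.iRoot y) (hr' : ∃ y, H'.iRoot y)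
    (hH : ∀ v, ¬ H.Dominates v) (hH' : ∀ v, ¬ H'.Dominates v) :
    Nonempty (Iso G G') ∧ Nonempty (Iso H H') := by
  have char : ∀ {G H : LGraph}, G.Rooted → (∃ y, H.iRoot y) → (∀ v, ¬ H.Dominates v) →
      ∀ x, x.isLeft = true ↔ ∃ w, (G.bef H).istar x w ∧ (G.bef H).Dominates w := by
    intro G H hG hr hH
    rintro (x | x)
    · obtain ⟨w, h, hw⟩ := hG x
      refine iff_of_true rfl ⟨Sum.inl w, bef_istar_inl h, ?_⟩
      rintro (r | r) hr'
      · exact absurd hr' (bef_not_iRoot_inl hr)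
      · exact bef_iedge_inl_inr.2 ⟨hw, bef_iRoot_inr.1 hr'⟩
    · refine iff_of_false (by simp) ?_
      rintro ⟨w, h, hw⟩
      obtain ⟨z, rfl⟩ := bef_istar_inr_right h
      exact hH z fun r hr => bef_iedge_inr_inr.1 (hw _ (bef_iRoot_inr.2 hr))
  refine f.split_bef fun x => Bool.eq_iff_iff.2 ?_
  rw [char hG hr hH, char hG' hr' hH']
  constructor
  · rintro ⟨w, h, hw⟩
    refine ⟨f.symm.e w, ?_, (f.symm.dominates_iff w).1 hw⟩
    simpa [Iso.symm] using f.symm.istar h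
  · rintro ⟨w, h, hw⟩
    exact ⟨f.e w, f.istar h, (f.dominates_iff w).1 hw⟩

theorem Iso.isLeft_of_mbef (f : Iso (G.mbef H) (G'.mbef H')) (hG : ∀ x, G.iRoot x)
    (hm : ∀ x y, ¬ G.medge x y) (hG' : ∃ x', G'.iRoot x') (x : G.V) :
    (f.e (Sum.inl x)).isLeft := by
  obtain ⟨x', hx'⟩ := hG'
  have hr := (f.iRoot_iff (Sum.inl x)).1 (mbef_iRoot_inl.2 (hG x))
  have hnm : ∀ v, ¬ (G'.mbef H').medge v (f.e (Sum.inl x)) := by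
    refine f.e.surjective.forall.2 fun v hv => ?_
    have := (f.medge_iff v (Sum.inl x)).2 hv
    rcases v with v | v
    · exact hm v x (mbef_medge_inl_inl.1 this)
    · exact mbef_medge_inr_inl this
  generalize f.e (Sum.inl x) = z at hr hnm
  rcases z with z | z
  · rfl
  · exact (hnm (Sum.inl x') (mbef_medge_inl_inr.2 ⟨hx', mbef_iRoot_inr.1 hr⟩)).elim

/-- An isomorphism of graphs of modal formulas. -/
theorem Iso.cancel_mbef {l l' : MLabel}
    (f : Iso ((single l).mbef H) ((single l').mbef H')) : l = l' ∧ Nonempty (Iso H H') := by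
  have hr : ∀ l x, (single l).iRoot x := fun _ _ _ h => h
  have hm : ∀ l x y, ¬ (single l).medge x y := fun _ _ _ h => h
  obtain ⟨⟨g⟩, h⟩ := f.split_mbef (isLeft_eq_isLeft f.e
    (f.isLeft_of_mbef (hr l) (hm l) ⟨(), hr l' ()⟩)
    (f.symm.isLeft_of_mbef (hr l') (hm l') ⟨(), hr l ()⟩))
  exact ⟨(g.label_eq ()).symm, h⟩

/-- Some `→`-root has no incoming `→`-edge. -/
def HasIsolatedRoot (G : LGraph) : Prop := ∃ v, G.iRoot v ∧ ∀ w, ¬ G.iedge w v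

theorem Iso.hasIsolatedRoot (f : Iso G H) (h : G.HasIsolatedRoot) : H.HasIsolatedRoot := by
  obtain ⟨v, hv, hw⟩ := h
  refine ⟨f.e v, (f.iRoot_iff v).1 hv, f.e.surjective.forall.2 fun w => ?_⟩
  rw [← f.iedge_iff]
  exact hw w

theorem hasIsolatedRoot_single (l : MLabel) : (single l).HasIsolatedRoot :=
  ⟨(), fun _ h => h, fun _ h => h⟩

theorem hasIsolatedRoot_mbef (l : MLabel) : ((single l).mbef H).HasIsolatedRoot := by
  refine ⟨Sum.inl (), mbef_iRoot_inl.2 fun _ h => h, ?_⟩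
  rintro (w | w) h <;> exact h

theorem not_hasIsolatedRoot_bef (hG : ∃ x, G.iRoot x) (hH : ∃ y, H.iRoot y) :
    ¬ (G.bef H).HasIsolatedRoot := by
  obtain ⟨x, hx⟩ := hG
  rintro ⟨v | v, hv, hw⟩
  · exact bef_not_iRoot_inl hH hv
  · exact hw (Sum.inl x) (bef_iedge_inl_inr.2 ⟨hx, bef_iRoot_inr.1 hv⟩)

theorem isEmpty_iso_single_mbef (l l' : MLabel) (y : H.V) :
    IsEmpty (Iso (single l) ((single l').mbef H)) :=
  ⟨fun f => by
    have : f.e.symm (Sum.inl ()) = f.e.symm (Sum.inr y) := rfl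
    cases f.e.symm.injective this⟩

theorem not_dominates_gsum (hG : ∃ x, G.iRoot x) (hH : ∃ y, H.iRoot y) (v : (G.gsum H).V) :
    ¬ (G.gsum H).Dominates v := by
  obtain ⟨x, hx⟩ := hG
  obtain ⟨y, hy⟩ := hH
  intro h
  rcases v with v | v
  · exact h (Sum.inr y) (gsum_iRoot_inr.2 hy)
  · exact h (Sum.inl x) (gsum_iRoot_inl.2 hx)

theorem HasIsolatedRoot.not_dominates (h : G.HasIsolatedRoot) (v : G.V) : ¬ G.Dominates v :=
  fun hv => h.elim fun r hr => hr.2 v (hv r hr.1)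

end Operations

end LGraph

namespace MForm

/-- The number of vertices of `[[F]]`. -/
def size : MForm → ℕ
  | .atom _ => 1
  | .diaBot => 1
  | .conj A B => A.size + B.size
  | .imp A B => A.size + B.size
  | .box A => A.size + 1
  | .dia A => A.size + 1

theorem size_pos (F : MForm) : 0 < F.size := by
  induction F <;> simp [size] <;> omega

theorem exists_iRoot (F : MForm) : ∃ v, F.arena.iRoot v := by
  induction F with
  | atom a => exact ⟨(), fun _ h => h⟩
  | diaBot => exact ⟨(), fun _ h => h⟩
  | conj A B ihA _ => exact ihA.elim fun v hv => ⟨Sum.inl v, LGraph.gsum_iRoot_inl.2 hv⟩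
  | imp A B _ ihB => exact ihB.elim fun v hv => ⟨Sum.inr v, LGraph.bef_iRoot_inr.2 hv⟩
  | box A ih => exact ih.elim fun v hv => ⟨Sum.inr v, LGraph.mbef_iRoot_inr.2 hv⟩
  | dia A ih => exact ih.elim fun v hv => ⟨Sum.inr v, LGraph.mbef_iRoot_inr.2 hv⟩

theorem rooted_arena (F : MForm) : F.arena.Rooted := by
  have single : ∀ l, (LGraph.single l).Rooted :=
    fun _ _ => ⟨(), Relation.ReflTransGen.refl, fun _ h => h⟩
  induction F with
  | atom a => exact single _
  | diaBot => exact single _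
  | conj A B ihA ihB => exact ihA.gsum ihB
  | imp A B ihA ihB => exact ihA.bef ihB B.exists_iRoot
  | box A ih => exact (single _).mbef ih
  | dia A ih => exact (single _).mbef ih

/-- `F` is not a conjunction. -/
def NonConj (F : MForm) : Prop := ∀ A B, F ≠ conj A B

/-- `F` is not an implication. -/
def NonImp (F : MForm) : Prop := ∀ A B, F ≠ imp A B

theorem NonConj.connected {F : MForm} (h : F.NonConj) : F.arena.Connected := by
  cases F with
  | atom a => exact LGraph.connected_single _
  | diaBot => exact LGraph.connected_single _
  | conj A B => exact (h A B rfl).elim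
  | imp A B =>
    exact LGraph.connected_bef A.rooted_arena B.rooted_arena A.exists_iRoot B.exists_iRoot
  | box A => exact LGraph.connected_mbef _ A.rooted_arena
  | dia A => exact LGraph.connected_mbef _ A.rooted_arena

theorem NonImp.not_dominates {F : MForm} (h : F.NonImp) : ∀ v, ¬ F.arena.Dominates v := by
  cases F with
  | atom a => exact (LGraph.hasIsolatedRoot_single _).not_dominates
  | diaBot => exact (LGraph.hasIsolatedRoot_single _).not_dominates
  | conj A B => exact LGraph.not_dominates_gsum A.exists_iRoot B.exists_iRoot
  | imp A B => exact (h A B rfl).elim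
  | box A => exact (LGraph.hasIsolatedRoot_mbef _).not_dominates
  | dia A => exact (LGraph.hasIsolatedRoot_mbef _).not_dominates

/-- Uncurrying: every implication is equivalent to one whose conclusion is not an implication. -/
theorem exists_uncurry (A B : MForm) :
    ∃ C D : MForm, FEq (A.imp B) (C.imp D) ∧ D.NonImp := by
  induction B generalizing A with
  | imp B₁ B₂ _ ih =>
    obtain ⟨C, D, h, hD⟩ := ih (A.conj B₁)
    exact ⟨C, D, (FEq.curry A B₁ B₂).symm.trans h, hD⟩
  | _ => exact ⟨A, _, FEq.refl _, fun _ _ h => by cases h⟩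

/-- The conjunct of `F` containing a given vertex can be moved to the front. -/
theorem nonConj_or_exists_conjunct (F : MForm) (v : F.arena.V) :
    F.NonConj ∨ ∃ C R : MForm, C.NonConj ∧ FEq F (C.conj R) ∧
      ∃ (e : LGraph.Iso F.arena (C.arena.gsum R.arena)) (c : C.arena.V),
        e.e v = Sum.inl c := by
  induction F with
  | conj A B ihA ihB =>
    right
    have key : ∀ A B : MForm, ∀ a : A.arena.V, (A.NonConj ∨ ∃ C R : MForm, C.NonConj ∧
        FEq A (C.conj R) ∧ ∃ (e : LGraph.Iso A.arena (C.arena.gsum R.arena)) (c : C.arena.V),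
        e.e a = Sum.inl c) → ∃ C R : MForm, C.NonConj ∧ FEq (A.conj B) (C.conj R) ∧
        ∃ (e : LGraph.Iso (A.arena.gsum B.arena) (C.arena.gsum R.arena)) (c : C.arena.V),
        e.e (Sum.inl a) = Sum.inl c := by
      rintro A B a (hA | ⟨C, R, hC, hF, e, c, hc⟩)
      · exact ⟨A, B, hA, FEq.refl _, LGraph.Iso.refl _, a, rfl⟩
      · refine ⟨C, R.conj B, hC, (hF.conjC (FEq.refl B)).trans (FEq.assoc C R B).symm,
          (e.gsum (LGraph.Iso.refl _)).trans (LGraph.Iso.gsumAssoc _ _ _), c, ?_⟩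
        exact congrArg (fun z => Equiv.sumAssoc _ _ _ (Sum.inl z)) hc
    rcases v with a | b
    · exact key A B a (ihA a)
    · obtain ⟨C, R, hC, hF, e, c, hc⟩ := key B A b (ihB b)
      exact ⟨C, R, hC, (FEq.comm A B).trans hF, (LGraph.Iso.gsumComm _ _).trans e, c, hc⟩
  | _ => exact Or.inl fun _ _ h => by cases h

end MForm

theorem FEq.size_eq {F G : MForm} (h : FEq F G) : F.size = G.size := by
  induction h with
  | refl => rfl
  | symm _ ih => exact ih.symm
  | trans _ _ ih₁ ih₂ => exact ih₁.trans ih₂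
  | _ => simp only [MForm.size]; omega

theorem FEq.nonempty_iso {F G : MForm} (h : FEq F G) :
    Nonempty (LGraph.Iso F.arena G.arena) := by
  induction h with
  | comm A B => exact ⟨LGraph.Iso.gsumComm _ _⟩
  | assoc A B C => exact ⟨(LGraph.Iso.gsumAssoc _ _ _).symm⟩
  | curry A B C => exact ⟨LGraph.Iso.curry _ _ _ C.exists_iRoot⟩
  | refl A => exact ⟨LGraph.Iso.refl _⟩
  | symm _ ih => exact ih.map LGraph.Iso.symm
  | trans _ _ ih₁ ih₂ => exact ih₁.elim fun f => ih₂.map f.trans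
  | impC _ _ ih₁ ih₂ => exact ih₁.elim fun f => ih₂.map f.bef
  | conjC _ _ ih₁ ih₂ => exact ih₁.elim fun f => ih₂.map f.gsum
  | boxC _ ih => exact ih.map (LGraph.Iso.refl _).mbef
  | diaC _ ih => exact ih.map (LGraph.Iso.refl _).mbef

namespace LGraph.Iso

theorem feq_of_imp {A B A' B' : MForm}
    (ih : ∀ F G : MForm, F.size < (A.imp B).size → Iso F.arena G.arena → FEq F G)
    (f : Iso (A.imp B).arena (A'.imp B').arena) : FEq (A.imp B) (A'.imp B') := by
  obtain ⟨C, D, h, hD⟩ := A.exists_uncurry B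
  obtain ⟨C', D', h', hD'⟩ := A'.exists_uncurry B'
  obtain ⟨g⟩ := h.nonempty_iso
  obtain ⟨g'⟩ := h'.nonempty_iso
  obtain ⟨⟨p⟩, ⟨q⟩⟩ := cancel_bef ((g.symm.trans f).trans g') C.rooted_arena C'.rooted_arena
    D.exists_iRoot D'.exists_iRoot hD.not_dominates hD'.not_dominates
  have hs := h.size_eq
  have hC := C.size_pos
  have hDpos := D.size_pos
  rw [MForm.size, MForm.size] at hs
  exact (h.trans ((ih C C' (by rw [MForm.size]; omega) p).impC
    (ih D D' (by rw [MForm.size]; omega) q))).trans h'.symm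

theorem feq_of_nonConj {F G : MForm} (hF : F.NonConj) (hG : G.NonConj)
    (ih : ∀ F' G' : MForm, F'.size < F.size → Iso F'.arena G'.arena → FEq F' G')
    (f : Iso F.arena G.arena) : FEq F G := by
  have single : ∀ {l l'}, Iso (LGraph.single l) (LGraph.single l') → l = l' :=
    fun g => (g.label_eq ()).symm
  have hmod : ∀ {l l'} {A : MForm}, Iso (LGraph.single l) ((LGraph.single l').mbef A.arena) →
      False := fun {l l' A} g => (isEmpty_iso_single_mbef l l' A.exists_iRoot.choose).false g
  have himp : ∀ {A B : MForm} {K : LGraph}, K.HasIsolatedRoot →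
      Iso K (A.imp B).arena → False := fun {A B K} hK g =>
    not_hasIsolatedRoot_bef A.exists_iRoot B.exists_iRoot (g.hasIsolatedRoot hK)
  have hs := hasIsolatedRoot_single
  have hm := fun l (A : MForm) => hasIsolatedRoot_mbef (H := A.arena) l
  cases F with
  | conj A B => exact (hF A B rfl).elim
  | atom a =>
    cases G with
    | conj A B => exact (hG A B rfl).elim
    | atom b => cases single f; exact FEq.refl _
    | diaBot => cases single f
    | imp A B => exact (himp (hs _) f).elim
    | box A => exact (hmod f).elim
    | dia A => exact (hmod f).elim
  | diaBot =>
    cases G with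
    | conj A B => exact (hG A B rfl).elim
    | atom b => cases single f
    | diaBot => exact FEq.refl _
    | imp A B => exact (himp (hs _) f).elim
    | box A => exact (hmod f).elim
    | dia A => exact (hmod f).elim
  | imp A B =>
    cases G with
    | conj A B => exact (hG A B rfl).elim
    | atom b => exact (himp (hs _) f.symm).elim
    | diaBot => exact (himp (hs _) f.symm).elim
    | imp A' B' => exact feq_of_imp ih f
    | box A => exact (himp (hm _ _) f.symm).elim
    | dia A => exact (himp (hm _ _) f.symm).elim
  | box A =>
    cases G with
    | conj A B => exact (hG A B rfl).elim
    | atom b => exact (hmod f.symm).elim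
    | diaBot => exact (hmod f.symm).elim
    | imp A' B' => exact (himp (hm _ _) f).elim
    | box A' => exact (cancel_mbef f).2.elim fun g => (ih A A' (Nat.lt_succ_self _) g).boxC
    | dia A' => cases (cancel_mbef f).1
  | dia A =>
    cases G with
    | conj A B => exact (hG A B rfl).elim
    | atom b => exact (hmod f.symm).elim
    | diaBot => exact (hmod f.symm).elim
    | imp A' B' => exact (himp (hm _ _) f).elim
    | box A' => cases (cancel_mbef f).1
    | dia A' => exact (cancel_mbef f).2.elim fun g => (ih A A' (Nat.lt_succ_self _) g).diaC

theorem feq {F G : MForm} (f : Iso F.arena G.arena) : FEq F G := by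
  induction hn : F.size using Nat.strong_induction_on generalizing F G with
  | _ n ih =>
  subst hn
  have not_iso : ∀ {C R K : MForm}, K.NonConj → Iso K.arena (C.arena.gsum R.arena) → False :=
    fun {C R K} hK g => not_connected_gsum C.exists_iRoot.choose R.exists_iRoot.choose
      (g.connected hK.connected)
  obtain ⟨v, -⟩ := F.exists_iRoot
  rcases F.nonConj_or_exists_conjunct v with hF | ⟨C, R, hC, hF, e, c, hc⟩ <;>
    rcases G.nonConj_or_exists_conjunct (f.e v) with hG | ⟨C', R', hC', hG, e', c', hc'⟩
  · exact feq_of_nonConj hF hG (fun F' G' h g => ih F'.size h g rfl) f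
  · exact (not_iso hF (f.trans e')).elim
  · exact (not_iso hG (f.symm.trans e)).elim
  · have hv : e.e.symm (Sum.inl c) = v :=
      (congrArg e.e.symm hc).symm.trans (e.e.symm_apply_apply v)
    obtain ⟨⟨p⟩, ⟨q⟩⟩ := cancel_gsum (x := c) (x' := c') ((e.symm.trans f).trans e')
      hC.connected hC'.connected ((congrArg (fun z => e'.e (f.e z)) hv).trans hc')
    have hs := hF.size_eq
    have hCpos := C.size_pos
    have hRpos := R.size_pos
    rw [MForm.size] at hs
    exact (hF.trans ((ih C.size (by omega) p rfl).conjC (ih R.size (by omega) q rfl))).trans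
      hG.symm

end LGraph.Iso

/-- `F ≃f G` iff `[[F]]` and `[[G]]` are isomorphic. -/
theorem statement_8 (F G : MForm) :
    FEq F G ↔ Nonempty (LGraph.Iso F.arena G.arena) :=
  ⟨FEq.nonempty_iso, fun ⟨f⟩ => f.feq⟩
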